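/- arXiv:0810.5295 — 2 statements merged into one kernel-verified Lean document; each statement's English description precedes it below -/
import Mathlib

section
/- Let p, s, N be integers with 1 ≤ s ≤ p − 1 and 0 ≤ N ≤ p − s − 1, let β ≥ 0 be a real number with 2β > p − s − 2 − N, and let c > 0. Then there exists a constant C > 0 (depending only on p, s, N, β, c) such that for every real a > 0, ∫_{y ∈ ℝ^p, |y| < c} (a + |y|²)^{−β} · ∏_{ν=1}^{s} (|y_ν| + a + |y|²)^{−(1 + 1/s)} · |y|^{−N} dy ≤ C · a^{(p − s − 2 − N)/2 − β}. -/
open MeasureTheory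

theorem aux_scale {E : Type*} [NormedAddCommGroup E] [NormedSpace ℝ E] [MeasurableSpace E]
    [BorelSpace E] [FiniteDimensional ℝ E] (μ : Measure E) [μ.IsAddHaarMeasure]
    (f : E → ENNReal) (hf : Measurable f) {R : ℝ} (hR : 0 < R) :
    ∫⁻ x, f x ∂μ = ENNReal.ofReal (R ^ Module.finrank ℝ E) * ∫⁻ x, f (R • x) ∂μ := by
  have h := lintegral_map (μ := μ) hf (measurable_const_smul R)
  rw [Measure.map_addHaar_smul μ hR.ne', lintegral_smul_measure] at h
  rw [← h, smul_eq_mul, ← mul_assoc, ← ENNReal.ofReal_mul (by positivity),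
    abs_of_pos (by positivity), mul_inv_cancel₀ (by positivity)]
  simp

theorem aux_pi (s : ℕ) (f : ℝ → ENNReal) (hf : Measurable f) :
    ∫⁻ x : Fin s → ℝ, ∏ i, f (x i) = (∫⁻ t, f t) ^ s := by
  induction s with
  | zero => simp [volume_pi, Measure.pi_univ]
  | succ n ih =>
    have h := (volume_preserving_piFinSuccAbove (fun _ : Fin (n + 1) => ℝ) 0).symm
    rw [← h.lintegral_comp_emb (MeasurableEquiv.measurableEmbedding _)]
    rw [Measure.volume_eq_prod, lintegral_prod]
    · simp only [Fin.prod_univ_succ, MeasurableEquiv.piFinSuccAbove_symm_apply, Fin.insertNthEquiv,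
        Equiv.coe_fn_mk, Fin.insertNth_zero, Fin.cons_zero, Fin.cons_succ]
      have : ∀ t : ℝ, ∫⁻ y : Fin n → ℝ, f t * ∏ i, f (y i) = f t * (∫⁻ t, f t) ^ n := by
        intro t
        rw [lintegral_const_mul _ (by fun_prop), ih]
      calc _ = ∫⁻ t : ℝ, f t * (∫⁻ t, f t) ^ n := by
              refine lintegral_congr fun t => ?_
              rw [← this t]; rfl
        _ = _ := by rw [lintegral_mul_const _ hf, pow_succ']
    · exact ((by fun_prop : Measurable fun x : Fin (n+1) → ℝ => ∏ i, f (x i)).comp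
        (MeasurableEquiv.measurable _)).aemeasurable

theorem aux_one (ρ : ℝ) (A : ℝ) (hA : 0 < A) :
    ∫⁻ t : ℝ, ENNReal.ofReal ((|t| + A) ^ (-ρ)) =
      ENNReal.ofReal (A ^ (1 - ρ)) * ∫⁻ t : ℝ, ENNReal.ofReal ((1 + ‖t‖) ^ (-ρ)) := by
  rw [aux_scale volume _ (by fun_prop) hA, sub_eq_add_neg, Real.rpow_add hA,
    ENNReal.ofReal_mul (by positivity), mul_assoc]
  congr 1
  · simp
  rw [← lintegral_const_mul _ (by fun_prop)]
  refine lintegral_congr fun t => ?_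
  rw [← ENNReal.ofReal_mul (by positivity), ← Real.mul_rpow hA.le (by positivity)]
  congr 2
  rw [smul_eq_mul, abs_mul, abs_of_pos hA, Real.norm_eq_abs]; ring

theorem aux_int (q N : ℕ) (hN : N + 1 ≤ q) (γ : ℝ) (hγ : 0 ≤ γ) (h : (q : ℝ) - N < 2 * γ) :
    ∫⁻ u : Fin q → ℝ, ENNReal.ofReal ((1 + ‖u‖ ^ 2) ^ (-γ) * ‖u‖ ^ (-(N : ℝ))) ≠ ⊤ := by
  have : Nonempty (Fin q) := ⟨⟨0, by omega⟩⟩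
  have key : Integrable (fun u : Fin q → ℝ => (1 + ‖u‖ ^ 2) ^ (-γ) * ‖u‖ ^ (-(N : ℝ))) := by
    rw [integrable_fun_norm_addHaar volume
      (f := fun r : ℝ => (1 + r ^ 2) ^ (-γ) * r ^ (-(N : ℝ)))]
    have hb := (integrableOn_add_rpow_Ioi_of_lt (a := (q : ℝ) - 1 - N - 2 * γ) (c := 0) (m := 1)
      (by linarith) (by norm_num)).const_mul ((2 : ℝ) ^ γ)
    refine Integrable.mono' hb (by
      apply Measurable.aestronglyMeasurable; fun_prop) ?_
    filter_upwards [ae_restrict_mem measurableSet_Ioi] with r hr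
    have hr : 0 < r := hr
    have h1 : (1 + r ^ 2) ^ (-γ) ≤ 2 ^ γ * (r + 1) ^ (-(2 * γ)) := by
      have e : (2 : ℝ) ^ γ * (r + 1) ^ (-(2 * γ)) = ((r + 1) ^ 2 / 2) ^ (-γ) := by
        rw [Real.div_rpow (by positivity) (by positivity), Real.rpow_neg (by positivity : (0:ℝ) ≤ 2),
          div_inv_eq_mul, mul_comm, ← Real.rpow_natCast, ← Real.rpow_mul (by positivity)]
        congr 2; push_cast; ring
      rw [e]
      apply Real.rpow_le_rpow_of_nonpos (by positivity) _ (by linarith)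
      nlinarith [sq_nonneg (r - 1)]
    have h2 : r ^ (q - 1) * r ^ (-(N : ℝ)) ≤ (r + 1) ^ ((q : ℝ) - 1 - N) := by
      rw [← Real.rpow_natCast, ← Real.rpow_add hr]
      have hq : ((q - 1 : ℕ) : ℝ) + -(N : ℝ) = (q : ℝ) - 1 - N := by
        rw [Nat.cast_sub (by omega)]; push_cast; ring
      rw [hq]
      apply Real.rpow_le_rpow hr.le (by linarith)
      have : ((N + 1 : ℕ) : ℝ) ≤ q := by exact_mod_cast hN
      push_cast at this; linarith
    rw [Module.finrank_fin_fun, smul_eq_mul, Real.norm_of_nonneg (by positivity)]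
    calc r ^ (q - 1) * ((1 + r ^ 2) ^ (-γ) * r ^ (-(N : ℝ)))
        = (1 + r ^ 2) ^ (-γ) * (r ^ (q - 1) * r ^ (-(N : ℝ))) := by ring
      _ ≤ (2 ^ γ * (r + 1) ^ (-(2 * γ))) * (r + 1) ^ ((q : ℝ) - 1 - N) := by gcongr
      _ = _ := by
        rw [mul_assoc, ← Real.rpow_add (by positivity)]; congr 2; ring
  exact (key.lintegral_lt_top).ne

theorem aux_outer (q N : ℕ) (γ a : ℝ) (ha : 0 < a) :
    ∫⁻ u : Fin q → ℝ, ENNReal.ofReal ((a + ‖u‖ ^ 2) ^ (-γ) * ‖u‖ ^ (-(N : ℝ))) =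
      ENNReal.ofReal (a ^ (((q : ℝ) - N) / 2 - γ)) *
      ∫⁻ u : Fin q → ℝ, ENNReal.ofReal ((1 + ‖u‖ ^ 2) ^ (-γ) * ‖u‖ ^ (-(N : ℝ))) := by
  have hs : 0 < √a := Real.sqrt_pos.2 ha
  rw [aux_scale volume _ (by fun_prop) hs, Module.finrank_fin_fun]
  have e : a ^ (((q : ℝ) - N) / 2 - γ) = √a ^ q * (a ^ (-γ) * √a ^ (-(N : ℝ))) := by
    rw [Real.sqrt_eq_rpow, ← Real.rpow_natCast, ← Real.rpow_mul ha.le, ← Real.rpow_mul ha.le,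
      ← Real.rpow_add ha, ← Real.rpow_add ha]
    congr 1; ring
  rw [e, ENNReal.ofReal_mul (by positivity), mul_assoc]
  congr 1
  rw [← lintegral_const_mul _ (by fun_prop)]
  refine lintegral_congr fun u => ?_
  rw [← ENNReal.ofReal_mul (by positivity), norm_smul, Real.norm_of_nonneg hs.le, mul_pow,
    Real.sq_sqrt ha.le, Real.mul_rpow hs.le (by positivity),
    show a + a * ‖u‖ ^ 2 = a * (1 + ‖u‖ ^ 2) by ring, Real.mul_rpow ha.le (by positivity)]
  congr 1; ring

theorem aux_fubini (s q : ℕ) (F : EuclideanSpace ℝ (Fin (s + q)) → ENNReal) (hF : Measurable F) :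
    ∫⁻ y, F y = ∫⁻ u : Fin q → ℝ, ∫⁻ x : Fin s → ℝ, F (WithLp.toLp 2 (Fin.append x u)) := by
  have h1 := PiLp.volume_preserving_toLp (Fin (s + q))
  have h2 := volume_measurePreserving_piCongrLeft (fun _ : Fin (s + q) => ℝ) finSumFinEquiv
  have h3 := volume_measurePreserving_sumPiEquivProdPi_symm (fun _ : Fin s ⊕ Fin q => ℝ)
  have h := h1.comp (h2.comp h3)
  rw [← h.lintegral_comp hF, Measure.volume_eq_prod, lintegral_prod_symm]
  · refine lintegral_congr fun u => lintegral_congr fun x => ?_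
    simp only [Function.comp]
    congr 2
    funext i
    refine Fin.addCases (fun i => ?_) (fun i => ?_) i
    · rw [Fin.append_left, MeasurableEquiv.coe_piCongrLeft]
      have := Equiv.piCongrLeft_apply_apply (fun _ : Fin (s + q) => ℝ) finSumFinEquiv
        ((MeasurableEquiv.sumPiEquivProdPi fun _ : Fin s ⊕ Fin q => ℝ).symm (x, u)) (Sum.inl i)
      exact this.trans rfl
    · rw [Fin.append_right, MeasurableEquiv.coe_piCongrLeft]
      have := Equiv.piCongrLeft_apply_apply (fun _ : Fin (s + q) => ℝ) finSumFinEquiv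
        ((MeasurableEquiv.sumPiEquivProdPi fun _ : Fin s ⊕ Fin q => ℝ).symm (x, u)) (Sum.inr i)
      exact this.trans rfl
  · exact (hF.comp h.measurable).aemeasurable

theorem aux_norm (s q : ℕ) (x : Fin s → ℝ) (u : Fin q → ℝ) :
    ‖u‖ ≤ ‖(WithLp.toLp 2 (Fin.append x u) : EuclideanSpace ℝ (Fin (s + q)))‖ := by
  rw [pi_norm_le_iff_of_nonneg (norm_nonneg _)]
  intro i
  have := PiLp.norm_apply_le (WithLp.toLp 2 (Fin.append x u) : EuclideanSpace ℝ (Fin (s + q)))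
    (Fin.natAdd s i)
  simpa using this

theorem stmt_3 (p s N : ℕ) (hs1 : 1 ≤ s) (hsp : s + 1 ≤ p) (hN : N + s + 1 ≤ p)
    (β c : ℝ) (hβ : 0 ≤ β) (h2β : (p : ℝ) - s - 2 - N < 2 * β) (hc : 0 < c) :
    ∃ C : ℝ, 0 < C ∧ ∀ a : ℝ, 0 < a →
      ∫⁻ y in {y : EuclideanSpace ℝ (Fin p) | ‖y‖ < c},
          ENNReal.ofReal ((a + ‖y‖ ^ 2) ^ (-β) *
            (∏ ν : Fin s,
              (|y (Fin.castLE (Nat.le_of_succ_le hsp) ν)| + a + ‖y‖ ^ 2) ^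
                (-(1 + 1 / (s : ℝ)))) *
            ‖y‖ ^ (-(N : ℝ))) ≤
        ENNReal.ofReal (C * a ^ (((p : ℝ) - s - 2 - N) / 2 - β)) := by
  obtain ⟨q, rfl⟩ : ∃ q, p = s + q := ⟨p - s, by omega⟩
  have hq : N + 1 ≤ q := by omega
  have : Nonempty (Fin q) := ⟨⟨0, by omega⟩⟩
  have hs0 : (0 : ℝ) < s := by exact_mod_cast hs1
  push_cast at h2β
  set ρ : ℝ := 1 + 1 / (s : ℝ) with hρ
  have hρ1 : 1 < ρ := by
    have : 0 < 1 / (s : ℝ) := by positivity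
    linarith
  set K1 : ENNReal := ∫⁻ t : ℝ, ENNReal.ofReal ((1 + ‖t‖) ^ (-ρ)) with hK1
  set K2 : ENNReal := ∫⁻ u : Fin q → ℝ,
    ENNReal.ofReal ((1 + ‖u‖ ^ 2) ^ (-(β + 1)) * ‖u‖ ^ (-(N : ℝ))) with hK2
  have hK1t : K1 ≠ ⊤ :=
    ((integrable_one_add_norm (μ := (volume : Measure ℝ)) (r := ρ)
      (by simpa using hρ1)).lintegral_lt_top).ne
  have hK2t : K2 ≠ ⊤ := aux_int q N hq (β + 1) (by linarith) (by linarith)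
  have hKt : K1 ^ s * K2 ≠ ⊤ := ENNReal.mul_ne_top (ENNReal.pow_ne_top hK1t) hK2t
  refine ⟨(K1 ^ s * K2).toReal + 1, by positivity, fun a ha => ?_⟩
  refine (setLIntegral_le_lintegral _ _).trans ?_
  rw [aux_fubini s q _ (by fun_prop)]
  have hin : ∀ A : ℝ, 0 < A → ∫⁻ x : Fin s → ℝ, ∏ i, ENNReal.ofReal ((|x i| + A) ^ (-ρ)) =
      ENNReal.ofReal (A ^ (-1 : ℝ)) * K1 ^ s := by
    intro A hA
    rw [aux_pi s (fun t => ENNReal.ofReal ((|t| + A) ^ (-ρ))) (by fun_prop), aux_one ρ A hA,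
      mul_pow, ← ENNReal.ofReal_pow (by positivity), ← Real.rpow_natCast, ← Real.rpow_mul hA.le]
    congr 3
    rw [hρ]; field_simp; ring
  have hae : ∀ᵐ u : Fin q → ℝ, u ≠ 0 := by
    simp [ae_iff]
  calc _ ≤ ∫⁻ u : Fin q → ℝ, K1 ^ s *
        ENNReal.ofReal ((a + ‖u‖ ^ 2) ^ (-(β + 1)) * ‖u‖ ^ (-(N : ℝ))) := by
        refine lintegral_mono_ae ?_
        filter_upwards [hae] with u hu
        have hu' : 0 < ‖u‖ := norm_pos_iff.2 hu
        have hA : 0 < a + ‖u‖ ^ 2 := by positivity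
        calc _ ≤ ∫⁻ x : Fin s → ℝ, ENNReal.ofReal ((a + ‖u‖ ^ 2) ^ (-β) * ‖u‖ ^ (-(N : ℝ))) *
              ∏ i, ENNReal.ofReal ((|x i| + (a + ‖u‖ ^ 2)) ^ (-ρ)) := by
              refine lintegral_mono fun x => ?_
              rw [← ENNReal.ofReal_prod_of_nonneg (fun i _ => by positivity),
                ← ENNReal.ofReal_mul (by positivity)]
              apply ENNReal.ofReal_le_ofReal
              have hn := aux_norm s q x u
              set y : EuclideanSpace ℝ (Fin (s + q)) := WithLp.toLp 2 (Fin.append x u) with hy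
              have hyi : ∀ ν : Fin s, Fin.append x u (Fin.castLE (Nat.le_of_succ_le hsp) ν) = x ν := by
                intro ν
                exact Fin.append_left x u ν
              simp only [hyi]
              have hsq : ‖u‖ ^ 2 ≤ ‖y‖ ^ 2 := by gcongr
              have b1 : (a + ‖y‖ ^ 2) ^ (-β) ≤ (a + ‖u‖ ^ 2) ^ (-β) :=
                Real.rpow_le_rpow_of_nonpos hA (by linarith) (by linarith)
              have b2 : ‖y‖ ^ (-(N : ℝ)) ≤ ‖u‖ ^ (-(N : ℝ)) :=
                Real.rpow_le_rpow_of_nonpos hu' hn (by simp)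
              have b3 : ∏ ν : Fin s, (|x ν| + a + ‖y‖ ^ 2) ^ (-ρ) ≤
                  ∏ ν : Fin s, (|x ν| + (a + ‖u‖ ^ 2)) ^ (-ρ) := by
                refine Finset.prod_le_prod (fun i _ => by positivity) fun i _ => ?_
                exact Real.rpow_le_rpow_of_nonpos (by positivity) (by linarith) (by linarith)
              have p3 : 0 ≤ ∏ ν : Fin s, (|x ν| + a + ‖y‖ ^ 2) ^ (-ρ) :=
                Finset.prod_nonneg fun i _ => by positivity
              rw [mul_right_comm]
              exact mul_le_mul (mul_le_mul b1 b2 (by positivity) (by positivity)) b3 p3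
                (by positivity)
          _ = ENNReal.ofReal ((a + ‖u‖ ^ 2) ^ (-β) * ‖u‖ ^ (-(N : ℝ))) *
              (ENNReal.ofReal ((a + ‖u‖ ^ 2) ^ (-1 : ℝ)) * K1 ^ s) := by
              rw [lintegral_const_mul _ (by fun_prop), hin _ hA]
          _ = _ := by
              rw [← mul_assoc, mul_comm, ← ENNReal.ofReal_mul (by positivity), neg_add,
                Real.rpow_add hA]
              congr 2; ring
    _ = K1 ^ s * (ENNReal.ofReal (a ^ (((q : ℝ) - N) / 2 - (β + 1))) * K2) := by
        rw [lintegral_const_mul _ (by fun_prop), aux_outer q N (β + 1) a ha]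
    _ = ENNReal.ofReal ((K1 ^ s * K2).toReal) *
          ENNReal.ofReal (a ^ (((q : ℝ) - N) / 2 - (β + 1))) := by
        rw [ENNReal.ofReal_toReal hKt]; ring
    _ ≤ _ := by
        rw [← ENNReal.ofReal_mul (by positivity)]
        apply ENNReal.ofReal_le_ofReal
        have : (((s + q : ℕ) : ℝ) - s - 2 - N) / 2 - β = ((q : ℝ) - N) / 2 - (β + 1) := by
          push_cast; ring
        rw [this]
        gcongr
        linarith
end

section
/- Let m, s, N be integers with m ≥ 3, 1 ≤ s ≤ m − 2 and 0 ≤ N ≤ m − s − 2, let β be a real number with 0 < β < 1 and 2β > m − s − 3 − N, and let c > 0. Then there exists a constant C > 0 (depending only on m, s, N, β, c) such that for every real a > 0, ∫_{y ∈ ℝ^m, |y| < c} |y₁|^{−β} · (|y₁| + a + |y|²)^{−1} · ∏_{ν=2}^{s+1} (|y_ν| + a + |y|²)^{−(1 + 1/s)} · |y|^{−N} dy ≤ C · a^{(m − s − 3 − N)/2 − β}. -/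
open MeasureTheory

lemma aux_int_s4 (b q : ℝ) (hb1 : b < 1) (hbq : 1 < b + q) :
    Integrable (fun t : ℝ => |t| ^ (-b) * (|t| + 1) ^ (-q)) := by
  have hq : 0 < q := by linarith
  have hmeas : Measurable (fun t : ℝ => |t| ^ (-b) * (|t| + 1) ^ (-q)) := by fun_prop
  have h1 : IntegrableOn (fun t : ℝ => |t| ^ (-b) * (|t| + 1) ^ (-q)) (Set.Ioo 0 1) := by
    refine Integrable.mono' (g := fun t : ℝ => t ^ (-b))
      ((intervalIntegral.integrableOn_Ioo_rpow_iff one_pos).2 (by linarith))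
      hmeas.aestronglyMeasurable ?_
    refine (ae_restrict_iff' measurableSet_Ioo).2 (Filter.Eventually.of_forall fun t ht => ?_)
    rw [Real.norm_of_nonneg (by positivity), abs_of_pos ht.1]
    have : (t + 1) ^ (-q) ≤ 1 := Real.rpow_le_one_of_one_le_of_nonpos (by linarith [ht.1]) (by linarith)
    have h0 : 0 ≤ t ^ (-b) := Real.rpow_nonneg ht.1.le _
    nlinarith
  have h2 : IntegrableOn (fun t : ℝ => |t| ^ (-b) * (|t| + 1) ^ (-q)) (Set.Ici 1) := by
    rw [integrableOn_Ici_iff_integrableOn_Ioi]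
    refine Integrable.mono' (g := fun t : ℝ => t ^ (-b - q))
      (integrableOn_Ioi_rpow_of_lt (by linarith) one_pos)
      hmeas.aestronglyMeasurable ?_
    refine (ae_restrict_iff' measurableSet_Ioi).2 (Filter.Eventually.of_forall fun t ht => ?_)
    have ht0 : (0:ℝ) < t := lt_trans one_pos ht
    rw [Real.norm_of_nonneg (by positivity), abs_of_pos ht0, sub_eq_add_neg, Real.rpow_add ht0]
    have : (t + 1) ^ (-q) ≤ t ^ (-q) :=
      Real.rpow_le_rpow_of_nonpos ht0 (by linarith) (by linarith)
    gcongr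
  have hf : IntegrableOn (fun t : ℝ => |t| ^ (-b) * (|t| + 1) ^ (-q)) (Set.Ioi 0) := by
    rw [← Set.Ioo_union_Ici_eq_Ioi one_pos]
    exact h1.union h2
  have hg : IntegrableOn (fun t : ℝ => |t| ^ (-b) * (|t| + 1) ^ (-q)) (Set.Iic 0) := by
    rw [← Measure.map_neg_eq_self (volume : Measure ℝ)]
    let m : MeasurableEmbedding fun x : ℝ => -x := (Homeomorph.neg ℝ).measurableEmbedding
    rw [m.integrableOn_map_iff]
    simp_rw [Function.comp_def, abs_neg, Set.neg_preimage, Set.neg_Iic, neg_zero]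
    exact Iff.mpr integrableOn_Ici_iff_integrableOn_Ioi hf
  rw [← integrableOn_univ, ← Set.Iic_union_Ioi (a := (0:ℝ))]
  exact hg.union hf

lemma aux_one_s4 (b q : ℝ) (hb1 : b < 1) (hbq : 1 < b + q) :
    ∃ K : ℝ, 0 ≤ K ∧ ∀ A : ℝ, 0 < A →
      ∫⁻ t : ℝ, ENNReal.ofReal (|t| ^ (-b) * (|t| + A) ^ (-q)) ≤
        ENNReal.ofReal (K * A ^ (1 - b - q)) := by
  refine ⟨∫ t : ℝ, |t| ^ (-b) * (|t| + 1) ^ (-q), integral_nonneg fun t => by positivity, ?_⟩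
  intro A hA
  have hmeas : Measurable (fun t : ℝ => ENNReal.ofReal (|t| ^ (-b) * (|t| + A) ^ (-q))) := by
    fun_prop
  have h := congrArg (fun μ => ∫⁻ t, ENNReal.ofReal (|t| ^ (-b) * (|t| + A) ^ (-q)) ∂μ)
    (Real.smul_map_volume_mul_left hA.ne')
  beta_reduce at h
  rw [← h, lintegral_smul_measure, lintegral_map hmeas (by fun_prop), smul_eq_mul,
    abs_of_pos hA]
  have h2 : ∀ t : ℝ, ENNReal.ofReal (|A * t| ^ (-b) * (|A * t| + A) ^ (-q)) =
      ENNReal.ofReal (A ^ (-b - q)) * ENNReal.ofReal (|t| ^ (-b) * (|t| + 1) ^ (-q)) := by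
    intro t
    rw [← ENNReal.ofReal_mul (by positivity)]
    congr 1
    rw [abs_mul, abs_of_pos hA, show A * |t| + A = A * (|t| + 1) by ring,
      Real.mul_rpow hA.le (abs_nonneg _), Real.mul_rpow hA.le (by positivity), sub_eq_add_neg,
      Real.rpow_add hA]
    ring
  simp_rw [h2]
  rw [lintegral_const_mul _ (by fun_prop), ← ofReal_integral_eq_lintegral_ofReal
    (aux_int_s4 b q hb1 hbq) (Filter.Eventually.of_forall fun t => by positivity),
    ← ENNReal.ofReal_mul (by positivity), ← ENNReal.ofReal_mul (by positivity)]
  apply le_of_eq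
  congr 1
  rw [show 1 - b - q = 1 + (-b - q) by ring, Real.rpow_add hA, Real.rpow_one]
  ring

lemma aux_prod (n : ℕ) (f : Fin n → ℝ → ℝ) (hf : ∀ i, Measurable (f i))
    (hf0 : ∀ i t, 0 ≤ f i t) (C : Fin n → ℝ) (hC : ∀ i, 0 ≤ C i)
    (h : ∀ i, ∫⁻ t, ENNReal.ofReal (f i t) ≤ ENNReal.ofReal (C i)) :
    ∫⁻ x : Fin n → ℝ, ENNReal.ofReal (∏ i, f i (x i)) ≤ ENNReal.ofReal (∏ i, C i) := by
  induction n with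
  | zero => simp [volume_pi]
  | succ n ih =>
    rw [(volume_preserving_piFinSuccAbove (fun _ : Fin (n+1) => ℝ) 0).symm.lintegral_map_equiv
      (fun x : Fin (n+1) → ℝ => ENNReal.ofReal (∏ i, f i (x i)))]
    simp only [Fin.prod_univ_succ, MeasurableEquiv.piFinSuccAbove_symm_apply,
      Fin.insertNthEquiv_apply, Fin.insertNth_zero', Fin.cons_zero, Fin.cons_succ]
    simp_rw [ENNReal.ofReal_mul (hf0 0 _), ENNReal.ofReal_mul (hC 0)]
    rw [Measure.volume_eq_prod, lintegral_prod_mul (f := fun t => ENNReal.ofReal (f 0 t))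
      (g := fun x : Fin n → ℝ => ENNReal.ofReal (∏ i, f i.succ (x i)))]
    · gcongr
      · exact h 0
      · exact ih (fun i => f i.succ) (fun i => hf _) (fun i => hf0 _) (fun i => C i.succ) (fun i => hC _) (fun i => h _)
    · exact (hf 0).ennreal_ofReal.aemeasurable
    · exact (Finset.measurable_prod _ fun i _ =>
        (hf i.succ).comp (measurable_pi_apply i)).ennreal_ofReal.aemeasurable

lemma aux_split (k p : ℕ) (F : EuclideanSpace ℝ (Fin (k + p)) → ENNReal) (hF : Measurable F) :
    ∫⁻ y, F y = ∫⁻ z : Fin p → ℝ, ∫⁻ x : Fin k → ℝ, F (WithLp.toLp 2 (Fin.append x z)) := by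
  have e1 := (volume_measurePreserving_sumPiEquivProdPi_symm (fun _ : Fin k ⊕ Fin p => ℝ))
  have e2 := (volume_measurePreserving_piCongrLeft (fun _ : Fin (k+p) => ℝ) finSumFinEquiv)
  have e3 := PiLp.volume_preserving_toLp (Fin (k + p))
  have e := e3.comp (e2.comp e1)
  have he : ∀ w : (Fin k → ℝ) × (Fin p → ℝ), (WithLp.toLp 2 ∘ (MeasurableEquiv.piCongrLeft (fun _ : Fin (k+p) => ℝ) finSumFinEquiv) ∘ (MeasurableEquiv.sumPiEquivProdPi (fun _ : Fin k ⊕ Fin p => ℝ)).symm) w = WithLp.toLp 2 (Fin.append w.1 w.2) := by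
    intro w
    simp only [Function.comp_apply]
    congr 1
    ext i
    obtain ⟨j, rfl⟩ := finSumFinEquiv.surjective i
    rw [MeasurableEquiv.coe_piCongrLeft, Equiv.piCongrLeft_apply_apply]
    rcases j with j | j
    · simp [MeasurableEquiv.sumPiEquivProdPi, Equiv.sumPiEquivProdPi]
    · simp [MeasurableEquiv.sumPiEquivProdPi, Equiv.sumPiEquivProdPi]
  rw [← e.lintegral_comp hF]
  rw [Measure.volume_eq_prod, lintegral_prod_symm' _ (by exact hF.comp e.measurable)]
  simp only [he]


lemma aux_pt (p : ℕ) (hp : 0 < p) (n β a : ℝ) (hn : 0 ≤ n) (hβ : 0 < β) (ha : 0 < a)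
    (z : Fin p → ℝ) (hz : ∀ j, z j ≠ 0) :
    (a + ∑ j, z j ^ 2) ^ (-(1 + β)) * √(∑ j, z j ^ 2) ^ (-n) ≤
      2 ^ (1 + β) * ∏ j, (|z j| ^ (-(n / p)) * (|z j| + √a) ^ (-(2 * (1 + β) / p))) := by
  have hp' : (0:ℝ) < p := by exact_mod_cast hp
  set Z := ∑ j, z j ^ 2 with hZ
  have hzZ : ∀ j, z j ^ 2 ≤ Z := fun j =>
    Finset.single_le_sum (f := fun j => z j ^ 2) (fun i _ => sq_nonneg _) (Finset.mem_univ j)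
  have hZ0 : 0 < Z := lt_of_lt_of_le (by have := hz ⟨0, hp⟩; positivity) (hzZ ⟨0, hp⟩)
  have h1 : √Z ^ (-n) * (2 * (a + Z)) ^ (-(1 + β)) =
      ∏ j : Fin p, (√Z ^ (-(n / p)) * (2 * (a + Z)) ^ (-((1 + β) / p))) := by
    rw [Finset.prod_const, Finset.card_univ, Fintype.card_fin, mul_pow, ← Real.rpow_natCast,
      ← Real.rpow_natCast, ← Real.rpow_mul (by positivity), ← Real.rpow_mul (by positivity)]
    congr 2 <;> field_simp
  have h2 : (a + Z) ^ (-(1 + β)) = 2 ^ (1 + β) * (2 * (a + Z)) ^ (-(1 + β)) := by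
    rw [Real.mul_rpow (by positivity) (by positivity), ← mul_assoc, ← Real.rpow_add (by positivity)]
    simp
  rw [h2, mul_assoc, mul_comm (_ ^ (-(1 + β))), h1]
  gcongr 2 ^ (1 + β) * ?_
  refine Finset.prod_le_prod (fun j _ => by positivity) fun j _ => ?_
  refine mul_le_mul ?_ ?_ (by positivity) (by positivity)
  · have := abs_pos.2 (hz j)
    apply Real.rpow_le_rpow_of_nonpos this
    · exact Real.abs_le_sqrt (hzZ j)
    · simp only [Left.neg_nonpos_iff]; positivity
  · have := abs_pos.2 (hz j)
    rw [show -(2 * (1 + β) / p) = (2:ℝ) * (-((1 + β) / p)) by ring, Real.rpow_mul (by positivity)]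
    apply Real.rpow_le_rpow_of_nonpos (by positivity)
    · rw [Real.rpow_two]
      have h3 := Real.sq_sqrt ha.le
      have h4 := sq_abs (z j)
      have h5 := hzZ j
      nlinarith [sq_nonneg (|z j| - √a)]
    · simp only [Left.neg_nonpos_iff]; positivity

lemma aux_inner (s : ℕ) (hs1 : 1 ≤ s) (K1 K2 β A W : ℝ) (hA : 0 < A) (hW : 0 ≤ W)
    (hK1 : 0 ≤ K1) (hK2 : 0 ≤ K2)
    (h1 : ∫⁻ t : ℝ, ENNReal.ofReal (|t| ^ (-β) * (|t| + A) ^ (-(1:ℝ))) ≤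
        ENNReal.ofReal (K1 * A ^ (1 - β - 1)))
    (h2 : ∫⁻ t : ℝ, ENNReal.ofReal (|t| ^ (-(0:ℝ)) * (|t| + A) ^ (-(1 + 1 / (s:ℝ)))) ≤
        ENNReal.ofReal (K2 * A ^ (1 - 0 - (1 + 1 / (s:ℝ))))) :
    ∫⁻ x : Fin (s + 1) → ℝ, ENNReal.ofReal (|x 0| ^ (-β) * (|x 0| + A) ^ (-(1:ℝ)) *
      (∏ ν : Fin s, (|x ν.succ| + A) ^ (-(1 + 1 / (s:ℝ)))) * W) ≤
      ENNReal.ofReal (K1 * K2 ^ s * (A ^ (-(1 + β)) * W)) := by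
  have hs : (s:ℝ) ≠ 0 := by positivity
  have h := aux_prod (s + 1)
    (Fin.cons (fun t : ℝ => |t| ^ (-β) * (|t| + A) ^ (-(1:ℝ)))
      (fun _ => fun t : ℝ => |t| ^ (-(0:ℝ)) * (|t| + A) ^ (-(1 + 1 / (s:ℝ)))))
    (by
      intro i
      refine Fin.cases ?_ (fun i => ?_) i
      · simp only [Fin.cons_zero]; fun_prop
      · simp only [Fin.cons_succ]; fun_prop)
    (by
      intro i t
      refine Fin.cases ?_ (fun i => ?_) i
      · simp only [Fin.cons_zero]; positivity
      · simp only [Fin.cons_succ]; positivity)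
    (Fin.cons (K1 * A ^ (1 - β - 1)) (fun _ => K2 * A ^ (1 - 0 - (1 + 1 / (s:ℝ)))))
    (by
      intro i
      refine Fin.cases ?_ (fun i => ?_) i
      · simp only [Fin.cons_zero]; positivity
      · simp only [Fin.cons_succ]; positivity)
    (by
      intro i
      refine Fin.cases ?_ (fun i => ?_) i
      · simpa only [Fin.cons_zero] using h1
      · simpa only [Fin.cons_succ] using h2)
  simp only [Fin.prod_univ_succ, Fin.cons_zero, Fin.cons_succ, neg_zero, Real.rpow_zero,
    one_mul] at h
  simp_rw [ENNReal.ofReal_mul' hW]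
  rw [lintegral_mul_const _ (by fun_prop)]
  refine (mul_le_mul_left h _).trans ?_
  rw [← ENNReal.ofReal_mul' hW]
  apply le_of_eq
  congr 1
  rw [Finset.prod_const, Finset.card_univ, Fintype.card_fin, mul_pow, ← Real.rpow_natCast (A ^ _),
    ← Real.rpow_mul hA.le, show (1 - 0 - (1 + 1 / (s:ℝ))) * s = -1 by field_simp; ring,
    show -(1 + β) = (1 - β - 1) + (-1) by ring, Real.rpow_add hA]
  ring

theorem stmt_4 (m s N : ℕ) (hm : 3 ≤ m) (hs1 : 1 ≤ s) (hs2 : s + 2 ≤ m)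
    (hN : N + s + 2 ≤ m) (β c : ℝ) (hβ0 : 0 < β) (hβ1 : β < 1)
    (h2β : (m : ℝ) - s - 3 - N < 2 * β) (hc : 0 < c) :
    ∃ C : ℝ, 0 < C ∧ ∀ a : ℝ, 0 < a →
      ∫⁻ y in {y : EuclideanSpace ℝ (Fin m) | ‖y‖ < c},
          ENNReal.ofReal (|y ⟨0, by omega⟩| ^ (-β) *
            (|y ⟨0, by omega⟩| + a + ‖y‖ ^ 2) ^ (-(1 : ℝ)) *
            (∏ ν : Fin s,
              (|y ⟨ν.val + 1, by have := ν.isLt; omega⟩| + a + ‖y‖ ^ 2) ^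
                (-(1 + 1 / (s : ℝ)))) *
            ‖y‖ ^ (-(N : ℝ))) ≤
        ENNReal.ofReal (C * a ^ (((m : ℝ) - s - 3 - N) / 2 - β)) := by
  obtain ⟨p, rfl⟩ : ∃ p, m = s + 1 + p := ⟨m - (s + 1), by omega⟩
  have hp : 0 < p := by omega
  have hp' : (0:ℝ) < p := by exact_mod_cast hp
  have hs' : (0:ℝ) < s := by exact_mod_cast hs1
  have hNp : (N:ℝ) < p := by exact_mod_cast (by omega : N < p)
  push_cast at h2β
  obtain ⟨K1, hK1, h1⟩ := aux_one_s4 β 1 hβ1 (by linarith)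
  obtain ⟨K2, hK2, h2⟩ := aux_one_s4 0 (1 + 1 / (s:ℝ)) one_pos (by
    have : 0 < 1 / (s:ℝ) := by positivity
    linarith)
  obtain ⟨K3, hK3, h3⟩ := aux_one_s4 (N / p) (2 * (1 + β) / p) ((div_lt_one hp').2 hNp) (by
    rw [← add_div, lt_div_iff₀ hp']; linarith)
  refine ⟨K1 * K2 ^ s * 2 ^ (1 + β) * K3 ^ p + 1, by positivity, ?_⟩
  intro a ha
  refine (setLIntegral_le_lintegral _ _).trans ?_
  rw [aux_split (s + 1) p _ (by fun_prop)]
  have hae : ∀ᵐ z : Fin p → ℝ, ∀ j, z j ≠ 0 := by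
    rw [ae_all_iff]
    intro j
    exact (Measure.quasiMeasurePreserving_eval (fun _ : Fin p => (volume : Measure ℝ)) j).ae
      (Measure.ae_ne volume 0)
  calc _ ≤ ∫⁻ z : Fin p → ℝ, ENNReal.ofReal (K1 * K2 ^ s * 2 ^ (1 + β)) *
        ENNReal.ofReal (∏ j, (|z j| ^ (-(N / p : ℝ)) * (|z j| + √a) ^ (-(2 * (1 + β) / p)))) := by
        refine lintegral_mono_ae ?_
        filter_upwards [hae] with z hz
        have hzZ : ∀ j, z j ^ 2 ≤ ∑ j, z j ^ 2 := fun j =>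
          Finset.single_le_sum (f := fun j => z j ^ 2) (fun i _ => sq_nonneg _) (Finset.mem_univ j)
        have hZ0 : 0 < ∑ j, z j ^ 2 :=
          lt_of_lt_of_le (by have := hz ⟨0, hp⟩; positivity) (hzZ ⟨0, hp⟩)
        have hA : 0 < a + ∑ j, z j ^ 2 := by positivity
        refine le_trans ?_ ((aux_inner s hs1 K1 K2 β (a + ∑ j, z j ^ 2)
          (√(∑ j, z j ^ 2) ^ (-(N:ℝ))) hA (by positivity) hK1 hK2 (h1 _ hA) (h2 _ hA)).trans ?_)
        · refine lintegral_mono fun x => ENNReal.ofReal_le_ofReal ?_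
          have e0 : Fin.append x z
              ⟨0, by omega⟩ = x 0 := Fin.append_left x z 0
          have e1 : ∀ ν : Fin s, Fin.append x z
              ⟨ν.val + 1, by have := ν.isLt; omega⟩ = x ν.succ :=
            fun ν => Fin.append_left x z ν.succ
          have hR : ∑ j, z j ^ 2 ≤
              ‖(WithLp.toLp 2 (Fin.append x z) : EuclideanSpace ℝ (Fin (s + 1 + p)))‖ ^ 2 := by
            rw [EuclideanSpace.real_norm_sq_eq, Fin.sum_univ_add]
            simp only [Fin.append_left, Fin.append_right]
            have : 0 ≤ ∑ i, x i ^ 2 := Finset.sum_nonneg fun i _ => sq_nonneg _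
            linarith
          have hR2 := Real.sqrt_le_left (norm_nonneg (WithLp.toLp 2 (Fin.append x z) : EuclideanSpace ℝ (Fin (s + 1 + p)))) |>.2 hR
          simp only [e0, e1]
          generalize ‖(WithLp.toLp 2 (Fin.append x z) : EuclideanSpace ℝ (Fin (s + 1 + p)))‖ = R at *
          have hm : ∀ (t q : ℝ), 0 ≤ q →
              (|t| + a + R ^ 2) ^ (-q) ≤ (|t| + (a + ∑ j, z j ^ 2)) ^ (-q) := by
            intro t q hq
            apply Real.rpow_le_rpow_of_nonpos (by positivity) (by linarith) (by linarith)
          have hRN : R ^ (-(N:ℝ)) ≤ √(∑ j, z j ^ 2) ^ (-(N:ℝ)) :=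
            Real.rpow_le_rpow_of_nonpos (by positivity) hR2 (by simp)
          have hR0 : 0 ≤ R := (Real.sqrt_nonneg _).trans hR2
          gcongr ?_ * ?_ * ?_ * ?_
          · exact hm _ _ zero_le_one
          · exact Finset.prod_le_prod (fun i _ => by positivity) fun i _ => hm _ _ (by positivity)
        · rw [← ENNReal.ofReal_mul (by positivity)]
          apply ENNReal.ofReal_le_ofReal
          rw [mul_assoc (K1 * K2 ^ s)]
          refine mul_le_mul_of_nonneg_left ?_ (by positivity)
          exact aux_pt p hp N β a (by positivity) hβ0 ha z hz
    _ ≤ ENNReal.ofReal (K1 * K2 ^ s * 2 ^ (1 + β)) * ENNReal.ofReal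
          (∏ j : Fin p, (K3 * √a ^ (1 - (N / p : ℝ) - 2 * (1 + β) / p))) := by
        rw [lintegral_const_mul _ (by fun_prop)]
        gcongr
        exact aux_prod p (fun _ t => |t| ^ (-(N / p : ℝ)) * (|t| + √a) ^ (-(2 * (1 + β) / p)))
          (fun _ => by fun_prop) (fun _ t => by positivity) _ (fun _ => by positivity)
          (fun _ => h3 _ (by positivity))
    _ ≤ _ := by
        rw [← ENNReal.ofReal_mul (by positivity)]
        apply ENNReal.ofReal_le_ofReal
        have he : (√a ^ (1 - (N / p : ℝ) - 2 * (1 + β) / p)) ^ p =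
            a ^ ((((s + 1 + p : ℕ) : ℝ) - s - 3 - N) / 2 - β) := by
          rw [Real.sqrt_eq_rpow, ← Real.rpow_natCast, ← Real.rpow_mul ha.le, ← Real.rpow_mul ha.le]
          congr 1
          push_cast
          field_simp
          ring
        rw [Finset.prod_const, Finset.card_univ, Fintype.card_fin, mul_pow, he, ← mul_assoc]
        gcongr
        linarith
end
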